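/- Let (v, u, S) be a C² solution of the Lagrangian duct equations v_t − u_x = 0, u_t + a p_x = 0, S_t = 0 for a polytropic ideal gas. Then the gradient variables α and β satisfy ∂₊α = k₁(k₂(3α + β) + (αβ − α²)) + k₃⁺(α − β) + F and ∂₋β = k₁(−k₂(α + 3β) + (αβ − β²)) + k₃⁻(β − α) + F, where k₁ = ((γ+1)/(2(γ−1))) K_c z^{2/(γ−1)}, k₂ = ((γ−1)/(γ(γ+1))) m_x z a^{−(γ−1)/2}, k₃^± = −((γ−1)/4) u a^{−1} ȧ ± (3(γ−1)²/8) m z a^{−(γ+1)/2} ȧ, and F = ((γ−1)³/(8K_c)) m² z^{(2γ−4)/(γ−1)} a^{−γ−1}(a ä − γ ȧ²) + ((γ−1)²/(2γ)) m m_x z² a^{−γ} ȧ. -/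

import Mathlib

open Real

/-- partial derivative in the first (space) variable -/
noncomputable def pdx (f : ℝ → ℝ → ℝ) (x t : ℝ) : ℝ := deriv (fun x' => f x' t) x
/-- partial derivative in the second (time) variable -/
noncomputable def pdt (f : ℝ → ℝ → ℝ) (x t : ℝ) : ℝ := deriv (fun t' => f x t') t

theorem hasDerivAt_pdx {f : ℝ → ℝ → ℝ} (hf : Differentiable ℝ (fun w : ℝ × ℝ => f w.1 w.2))
    (x t : ℝ) : HasDerivAt (fun x' => f x' t) (pdx f x t) x := by
  have h : DifferentiableAt ℝ (fun x' : ℝ => f x' t) x :=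
    (hf (x, t)).comp x (f := fun x' : ℝ => (x', t)) (by fun_prop)
  exact h.hasDerivAt

theorem hasDerivAt_pdt {f : ℝ → ℝ → ℝ} (hf : Differentiable ℝ (fun w : ℝ × ℝ => f w.1 w.2))
    (x t : ℝ) : HasDerivAt (fun t' => f x t') (pdt f x t) t := by
  have h : DifferentiableAt ℝ (fun t' : ℝ => f x t') t :=
    (hf (x, t)).comp t (f := fun t' : ℝ => (x, t')) (by fun_prop)
  exact h.hasDerivAt

theorem pdx_eq_fderiv {f : ℝ → ℝ → ℝ} (hf : Differentiable ℝ (fun w : ℝ × ℝ => f w.1 w.2))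
    (x t : ℝ) : pdx f x t = fderiv ℝ (fun w : ℝ × ℝ => f w.1 w.2) (x, t) (1, 0) :=
  ((hf (x, t)).hasFDerivAt.comp_hasDerivAt x (f := fun x' : ℝ => (x', t))
    ((hasDerivAt_id x).prodMk (hasDerivAt_const x t))).deriv

theorem pdt_eq_fderiv {f : ℝ → ℝ → ℝ} (hf : Differentiable ℝ (fun w : ℝ × ℝ => f w.1 w.2))
    (x t : ℝ) : pdt f x t = fderiv ℝ (fun w : ℝ × ℝ => f w.1 w.2) (x, t) (0, 1) :=
  ((hf (x, t)).hasFDerivAt.comp_hasDerivAt t (f := fun t' : ℝ => (x, t'))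
    ((hasDerivAt_const t x).prodMk (hasDerivAt_id t))).deriv

theorem differentiable_pdx {f : ℝ → ℝ → ℝ} (hf : ContDiff ℝ 2 (fun w : ℝ × ℝ => f w.1 w.2)) :
    Differentiable ℝ (fun w : ℝ × ℝ => pdx f w.1 w.2) := by
  have h : Differentiable ℝ (fderiv ℝ (fun w : ℝ × ℝ => f w.1 w.2)) :=
    (hf.fderiv_right (m := 1) (by norm_num)).differentiable (by norm_num)
  have e : (fun w : ℝ × ℝ => pdx f w.1 w.2)
      = fun w => fderiv ℝ (fun w : ℝ × ℝ => f w.1 w.2) w (1, 0) :=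
    funext fun w => pdx_eq_fderiv (hf.differentiable (by norm_num)) w.1 w.2
  rw [e]
  exact fun w => (h w).clm_apply (differentiableAt_const _)

theorem differentiable_pdt {f : ℝ → ℝ → ℝ} (hf : ContDiff ℝ 2 (fun w : ℝ × ℝ => f w.1 w.2)) :
    Differentiable ℝ (fun w : ℝ × ℝ => pdt f w.1 w.2) := by
  have h : Differentiable ℝ (fderiv ℝ (fun w : ℝ × ℝ => f w.1 w.2)) :=
    (hf.fderiv_right (m := 1) (by norm_num)).differentiable (by norm_num)
  have e : (fun w : ℝ × ℝ => pdt f w.1 w.2)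
      = fun w => fderiv ℝ (fun w : ℝ × ℝ => f w.1 w.2) w (0, 1) :=
    funext fun w => pdt_eq_fderiv (hf.differentiable (by norm_num)) w.1 w.2
  rw [e]
  exact fun w => (h w).clm_apply (differentiableAt_const _)

theorem pdt_pdx_comm {f : ℝ → ℝ → ℝ} (hf : ContDiff ℝ 2 (fun w : ℝ × ℝ => f w.1 w.2))
    (x t : ℝ) : pdt (pdx f) x t = pdx (pdt f) x t := by
  have hd := hf.differentiable (by norm_num)
  have h : Differentiable ℝ (fderiv ℝ (fun w : ℝ × ℝ => f w.1 w.2)) :=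
    (hf.fderiv_right (m := 1) (by norm_num)).differentiable (by norm_num)
  have hsymm : IsSymmSndFDerivAt ℝ (fun w : ℝ × ℝ => f w.1 w.2) (x, t) :=
    hf.contDiffAt.isSymmSndFDerivAt (by simp)
  have ex : (fun w : ℝ × ℝ => pdx f w.1 w.2)
      = fun w => fderiv ℝ (fun w : ℝ × ℝ => f w.1 w.2) w (1, 0) :=
    funext fun w => pdx_eq_fderiv hd w.1 w.2
  have et : (fun w : ℝ × ℝ => pdt f w.1 w.2)
      = fun w => fderiv ℝ (fun w : ℝ × ℝ => f w.1 w.2) w (0, 1) :=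
    funext fun w => pdt_eq_fderiv hd w.1 w.2
  rw [pdt_eq_fderiv (differentiable_pdx hf), pdx_eq_fderiv (differentiable_pdt hf), ex, et,
    fderiv_clm_apply (h _) (differentiableAt_const _),
    fderiv_clm_apply (h _) (differentiableAt_const _)]
  simpa using hsymm.eq (0, 1) (1, 0)

/-- The Riccati equations in algebraic form: `A` stands for `a ^ (-(γ - 1) / 2)` and `q` for
`(α - β) / 2`, while all other powers have been eliminated. -/
theorem riccati_of_reduced {γ : ℝ} (hγ : 1 < γ) {v u a A m z ad add C q : ℝ → ℝ → ℝ}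
    (hv : ContDiff ℝ 2 (fun w : ℝ × ℝ => v w.1 w.2))
    (hu : ContDiff ℝ 2 (fun w : ℝ × ℝ => u w.1 w.2))
    (ha : ContDiff ℝ 2 (fun w : ℝ × ℝ => a w.1 w.2))
    (hA : ContDiff ℝ 2 (fun w : ℝ × ℝ => A w.1 w.2))
    (hm : ContDiff ℝ 2 (fun w : ℝ × ℝ => m w.1 w.2))
    (hz : ContDiff ℝ 2 (fun w : ℝ × ℝ => z w.1 w.2))
    (had : ContDiff ℝ 2 (fun w : ℝ × ℝ => ad w.1 w.2))
    (hv0 : ∀ x t, v x t ≠ 0) (ha0 : ∀ x t, a x t ≠ 0)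
    (hax : ∀ x t, pdx a x t = v x t * ad x t)
    (hadx : ∀ x t, pdx ad x t = v x t * add x t)
    (hAx : ∀ x t, pdx A x t = -((γ - 1) / 2) * A x t * (v x t * ad x t) / a x t)
    (hAt : ∀ x t, pdt A x t = -((γ - 1) / 2) * A x t * (u x t * ad x t) / a x t)
    (hzx : ∀ x t, pdx z x t = -((γ - 1) / 2) * z x t * pdx v x t / v x t)
    (hzt : ∀ x t, pdt z x t = -((γ - 1) / 2) * z x t * pdx u x t / v x t)
    (hmt : ∀ x t, pdt m x t = 0)
    (hC : ∀ x t, C x t = (γ - 1) / 2 * A x t * m x t * z x t / v x t)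
    (hq : ∀ x t, q x t = A x t * (m x t * pdx z x t + (γ - 1) / γ * pdx m x t * z x t))
    (hut : ∀ x t, pdt u x t = -(C x t * q x t)
      + ((γ - 1) / 2) ^ 2 * m x t ^ 2 * A x t ^ 2 * z x t ^ 2 * ad x t / a x t)
    (x t : ℝ) :
    pdt (fun x t => pdx u x t + q x t) x t + C x t * pdx (fun x t => pdx u x t + q x t) x t
        = (γ + 1) / (4 * v x t) * ((γ - 1) / (γ * (γ + 1)) * pdx m x t * z x t * A x t
            * (3 * (pdx u x t + q x t) + (pdx u x t - q x t))
            + ((pdx u x t + q x t) * (pdx u x t - q x t) - (pdx u x t + q x t) ^ 2))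
          + (-((γ - 1) / 4) * u x t * (a x t)⁻¹ * ad x t
            + 3 * (γ - 1) ^ 2 / 8 * m x t * z x t * (A x t / a x t) * ad x t) * (2 * q x t)
          + ((γ - 1) ^ 2 / 4 * m x t ^ 2 * z x t ^ 2 * v x t * (A x t ^ 2 / a x t ^ 2)
              * (a x t * add x t - γ * ad x t ^ 2)
            + (γ - 1) ^ 2 / (2 * γ) * m x t * pdx m x t * z x t ^ 2
              * (A x t ^ 2 / a x t) * ad x t) ∧
    pdt (fun x t => pdx u x t - q x t) x t - C x t * pdx (fun x t => pdx u x t - q x t) x t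
        = (γ + 1) / (4 * v x t) * (-((γ - 1) / (γ * (γ + 1)) * pdx m x t * z x t * A x t)
            * ((pdx u x t + q x t) + 3 * (pdx u x t - q x t))
            + ((pdx u x t + q x t) * (pdx u x t - q x t) - (pdx u x t - q x t) ^ 2))
          + (-((γ - 1) / 4) * u x t * (a x t)⁻¹ * ad x t
            - 3 * (γ - 1) ^ 2 / 8 * m x t * z x t * (A x t / a x t) * ad x t) * (-(2 * q x t))
          + ((γ - 1) ^ 2 / 4 * m x t ^ 2 * z x t ^ 2 * v x t * (A x t ^ 2 / a x t ^ 2)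
              * (a x t * add x t - γ * ad x t ^ 2)
            + (γ - 1) ^ 2 / (2 * γ) * m x t * pdx m x t * z x t ^ 2
              * (A x t ^ 2 / a x t) * ad x t) := by
  have two : (2 : WithTop ℕ∞) ≠ 0 := by norm_num
  have hγ0 : γ ≠ 0 := by positivity
  have hγ1 : γ + 1 ≠ 0 := by positivity
  have hqd : Differentiable ℝ (fun w : ℝ × ℝ => q w.1 w.2) := by
    have e : (fun w : ℝ × ℝ => q w.1 w.2) = fun w => A w.1 w.2 *
        (m w.1 w.2 * pdx z w.1 w.2 + (γ - 1) / γ * pdx m w.1 w.2 * z w.1 w.2) :=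
      funext fun w => hq w.1 w.2
    rw [e]
    exact (hA.differentiable two).mul (((hm.differentiable two).mul (differentiable_pdx hz)).add
      (((differentiable_pdx hm).const_mul _).mul (hz.differentiable two)))
  have vx := hasDerivAt_pdx (hv.differentiable two) x t
  have ax := hasDerivAt_pdx (ha.differentiable two) x t
  have Ax := hasDerivAt_pdx (hA.differentiable two) x t
  have At := hasDerivAt_pdt (hA.differentiable two) x t
  have mx := hasDerivAt_pdx (hm.differentiable two) x t
  have mt := hasDerivAt_pdt (hm.differentiable two) x t
  have zx := hasDerivAt_pdx (hz.differentiable two) x t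
  have zt := hasDerivAt_pdt (hz.differentiable two) x t
  have adx := hasDerivAt_pdx (had.differentiable two) x t
  have uxx := hasDerivAt_pdx (differentiable_pdx hu) x t
  have uxt := hasDerivAt_pdt (differentiable_pdx hu) x t
  have zxt := hasDerivAt_pdt (differentiable_pdx hz) x t
  have mxt := hasDerivAt_pdt (differentiable_pdx hm) x t
  have qx := hasDerivAt_pdx hqd x t
  have qt := hasDerivAt_pdt hqd x t
  have mxt_eq : pdt (pdx m) x t = 0 := by
    rw [pdt_pdx_comm hm]
    simp [pdx, hmt]
  have zxt_eq : pdt (pdx z) x t = _ := (pdt_pdx_comm hz x t).trans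
    ((((zx.const_mul (-((γ - 1) / 2))).mul uxx).div vx (hv0 x t)).congr_of_eventuallyEq
      (.of_forall fun y => hzt y t)).deriv
  have uxt_eq : pdt (pdx u) x t = _ := (pdt_pdx_comm hu x t).trans
    ((((((((Ax.const_mul ((γ - 1) / 2)).mul mx).mul zx).div vx (hv0 x t)).mul qx).neg).add
      ((((((mx.pow 2).const_mul (((γ - 1) / 2) ^ 2)).mul (Ax.pow 2)).mul (zx.pow 2)).mul adx).div
        ax (ha0 x t))).congr_of_eventuallyEq
      (.of_forall fun y => by
        simp only [hut, hC, Pi.add_apply, Pi.mul_apply, Pi.neg_apply, Pi.div_apply, Pi.pow_apply])).deriv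
  have qt_eq : pdt q x t = _ :=
    ((At.mul ((mt.mul zxt).add ((mxt.const_mul ((γ - 1) / γ)).mul zt))).congr_of_eventuallyEq
      (.of_forall fun y => hq x y)).deriv
  have sum_t : pdt (fun x t => pdx u x t + q x t) x t = pdt (pdx u) x t + pdt q x t :=
    (uxt.add qt).deriv
  have sum_x : pdx (fun x t => pdx u x t + q x t) x t = pdx (pdx u) x t + pdx q x t :=
    (uxx.add qx).deriv
  have sub_t : pdt (fun x t => pdx u x t - q x t) x t = pdt (pdx u) x t - pdt q x t :=
    (uxt.sub qt).deriv
  have sub_x : pdx (fun x t => pdx u x t - q x t) x t = pdx (pdx u) x t - pdx q x t :=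
    (uxx.sub qx).deriv
  have hv0 := hv0 x t
  have ha0 := ha0 x t
  rw [sum_t, sum_x, sub_t, sub_x, qt_eq, uxt_eq, zxt_eq, mxt_eq]
  simp only [Pi.add_apply, Pi.mul_apply, Pi.div_apply, Pi.pow_apply]
  simp only [hmt, hax, hadx, hAx, hAt, hzt, hC, hq, hzx]
  generalize pdx q x t = qx
  constructor <;> (field_simp; ring)

theorem pdx_rpow {f : ℝ → ℝ → ℝ} (hf : Differentiable ℝ (fun w : ℝ × ℝ => f w.1 w.2))
    (hpos : ∀ x t, 0 < f x t) (r x t : ℝ) :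
    pdx (fun x t => f x t ^ r) x t = r * f x t ^ r * pdx f x t / f x t := by
  refine ((hasDerivAt_pdx hf x t).rpow_const (.inl (hpos x t).ne')).deriv.trans ?_
  rw [Real.rpow_sub_one (hpos x t).ne']
  ring

theorem pdt_rpow {f : ℝ → ℝ → ℝ} (hf : Differentiable ℝ (fun w : ℝ × ℝ => f w.1 w.2))
    (hpos : ∀ x t, 0 < f x t) (r x t : ℝ) :
    pdt (fun x t => f x t ^ r) x t = r * f x t ^ r * pdt f x t / f x t := by
  refine ((hasDerivAt_pdt hf x t).rpow_const (.inl (hpos x t).ne')).deriv.trans ?_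
  rw [Real.rpow_sub_one (hpos x t).ne']
  ring

theorem rpow_neg_eq_sq_div {b : ℝ} (hb : 0 < b) (γ : ℝ) :
    b ^ (-γ) = (b ^ (-((γ - 1) / 2))) ^ 2 / b := by
  rw [← Real.rpow_natCast, ← Real.rpow_mul hb.le, ← Real.rpow_sub_one hb.ne']
  congr 1
  push_cast
  ring

/-- coupled Riccati equations for the gradient variables `α, β`
of compressible flow of a polytropic ideal gas in a variable area duct. -/
theorem stmt15
    (K ctau γ : ℝ) (hK : 0 < K) (hctau : 0 < ctau) (hγ : 1 < γ)
    (Ktau Kc : ℝ)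
    (hKtau : Ktau = (2 * Real.sqrt (K * γ) / (γ - 1)) ^ ((2:ℝ) / (γ - 1)))
    (hKc : Kc = Real.sqrt (K * γ) * Ktau ^ (-((γ + 1) / 2)))
    (v u S a ad add : ℝ → ℝ → ℝ)
    (hvreg : ContDiff ℝ 2 (fun w : ℝ × ℝ => v w.1 w.2))
    (hureg : ContDiff ℝ 2 (fun w : ℝ × ℝ => u w.1 w.2))
    (hSreg : ContDiff ℝ 2 (fun w : ℝ × ℝ => S w.1 w.2))
    (hareg : ContDiff ℝ 2 (fun w : ℝ × ℝ => a w.1 w.2))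
    (hadreg : ContDiff ℝ 2 (fun w : ℝ × ℝ => ad w.1 w.2))
    (haddreg : ContDiff ℝ 2 (fun w : ℝ × ℝ => add w.1 w.2))
    (hvpos : ∀ x t, 0 < v x t) (hapos : ∀ x t, 0 < a x t)
    (hat : ∀ x t, pdt a x t = u x t * ad x t)
    (hax : ∀ x t, pdx a x t = v x t * ad x t)
    (hadt : ∀ x t, pdt ad x t = u x t * add x t)
    (hadx : ∀ x t, pdx ad x t = v x t * add x t)
    (p : ℝ → ℝ → ℝ)
    (hp : ∀ x t, p x t = K * Real.exp (S x t / ctau) * a x t ^ (-γ) * v x t ^ (-γ))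
    (hmass : ∀ x t, pdt v x t - pdx u x t = 0)
    (hmom : ∀ x t, pdt u x t + a x t * pdx p x t = 0)
    (hent : ∀ x t, pdt S x t = 0)
    (m z C α β : ℝ → ℝ → ℝ)
    (hm : ∀ x t, m x t = Real.exp (S x t / (2 * ctau)))
    (hz : ∀ x t, z x t = 2 * Real.sqrt (K * γ) / (γ - 1) * v x t ^ (-((γ - 1) / 2)))
    (hC : ∀ x t, C x t = Kc * a x t ^ (-((γ - 1) / 2)) * m x t
        * z x t ^ ((γ + 1) / (γ - 1)))
    (hα : ∀ x t, α x t = pdx u x t + a x t ^ (-((γ - 1) / 2))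
        * (m x t * pdx z x t + (γ - 1) / γ * pdx m x t * z x t))
    (hβ : ∀ x t, β x t = pdx u x t - a x t ^ (-((γ - 1) / 2))
        * (m x t * pdx z x t + (γ - 1) / γ * pdx m x t * z x t))
    (k1 k2 k3p k3m F : ℝ → ℝ → ℝ)
    (hk1 : ∀ x t, k1 x t = (γ + 1) / (2 * (γ - 1)) * Kc * z x t ^ ((2:ℝ) / (γ - 1)))
    (hk2 : ∀ x t, k2 x t = (γ - 1) / (γ * (γ + 1)) * pdx m x t * z x t
        * a x t ^ (-((γ - 1) / 2)))
    (hk3p : ∀ x t, k3p x t = -((γ - 1) / 4) * u x t * (a x t)⁻¹ * ad x t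
        + 3 * (γ - 1) ^ 2 / 8 * m x t * z x t * a x t ^ (-((γ + 1) / 2)) * ad x t)
    (hk3m : ∀ x t, k3m x t = -((γ - 1) / 4) * u x t * (a x t)⁻¹ * ad x t
        - 3 * (γ - 1) ^ 2 / 8 * m x t * z x t * a x t ^ (-((γ + 1) / 2)) * ad x t)
    (hF : ∀ x t, F x t =
      (γ - 1) ^ 3 / (8 * Kc) * m x t ^ 2 * z x t ^ ((2 * γ - 4) / (γ - 1))
          * a x t ^ (-γ - 1) * (a x t * add x t - γ * ad x t ^ 2)
        + (γ - 1) ^ 2 / (2 * γ) * m x t * pdx m x t * z x t ^ 2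
          * a x t ^ (-γ) * ad x t) :
    ∀ x t,
      (pdt α x t + C x t * pdx α x t
        = k1 x t * (k2 x t * (3 * α x t + β x t) + (α x t * β x t - α x t ^ 2))
          + k3p x t * (α x t - β x t) + F x t) ∧
      (pdt β x t - C x t * pdx β x t
        = k1 x t * (-(k2 x t) * (α x t + 3 * β x t) + (α x t * β x t - β x t ^ 2))
          + k3m x t * (β x t - α x t) + F x t) := by
  have two : (2 : WithTop ℕ∞) ≠ 0 := by norm_num
  have hγ0 : γ ≠ 0 := by positivity
  have hγ1 : γ - 1 ≠ 0 := (sub_pos.2 hγ).ne'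
  have hγ2 : 0 < γ - 1 := sub_pos.2 hγ
  have hs : 0 < Real.sqrt (K * γ) := Real.sqrt_pos.2 (by positivity)
  have hs2 : Real.sqrt (K * γ) ^ 2 = K * γ := Real.sq_sqrt (by positivity)
  obtain ⟨Z, hZ⟩ : ∃ Z, Z = 2 * Real.sqrt (K * γ) / (γ - 1) := ⟨_, rfl⟩
  have hZpos : 0 < Z := by rw [hZ]; positivity
  simp only [← hZ] at hz hKtau
  have hKtau0 : 0 < Ktau := hKtau ▸ Real.rpow_pos_of_pos hZpos _
  have hKK : Kc * Ktau = (γ - 1) / 2 := by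
    have e : Ktau ^ (-((γ + 1) / 2)) * Ktau = Z⁻¹ := by
      rw [← Real.rpow_add_one hKtau0.ne', hKtau, ← Real.rpow_mul hZpos.le, ← Real.rpow_neg_one]
      congr 1
      field_simp
      ring
    rw [hKc, mul_assoc, e, hZ]
    field_simp
  have hKc_eq : Kc = (γ - 1) / 2 / Ktau := eq_div_of_mul_eq hKtau0.ne' hKK
  have zpos : ∀ x t, 0 < z x t := fun x t => by
    rw [hz]
    exact mul_pos hZpos (Real.rpow_pos_of_pos (hvpos x t) _)
  have zpow : ∀ x t, z x t ^ ((2:ℝ) / (γ - 1)) = Ktau / v x t := fun x t => by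
    rw [hz, Real.mul_rpow hZpos.le (Real.rpow_pos_of_pos (hvpos x t) _).le, ← hKtau,
      ← Real.rpow_mul (hvpos x t).le, div_eq_mul_inv Ktau, ← Real.rpow_neg_one]
    congr 2
    field_simp
  have zpow_add : ∀ x t, z x t ^ ((γ + 1) / (γ - 1)) = z x t * (Ktau / v x t) := fun x t => by
    rw [← zpow, ← Real.rpow_one_add' (zpos x t).le (by positivity)]
    congr 1
    field_simp
    ring
  have zpow_sub : ∀ x t, z x t ^ ((2 * γ - 4) / (γ - 1)) = z x t ^ 2 / (Ktau / v x t) :=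
    fun x t => by
      rw [← zpow, ← Real.rpow_natCast, ← Real.rpow_sub (zpos x t)]
      congr 1
      push_cast
      field_simp
      ring
  obtain ⟨A, hAdef⟩ : ∃ A : ℝ → ℝ → ℝ, A = fun x t => a x t ^ (-((γ - 1) / 2)) := ⟨_, rfl⟩
  have hA : ∀ x t, a x t ^ (-((γ - 1) / 2)) = A x t := fun x t => by rw [hAdef]
  have apow : ∀ x t, a x t ^ (-γ) = A x t ^ 2 / a x t := fun x t => by
    rw [rpow_neg_eq_sq_div (hapos x t), hA]
  have apow_sub : ∀ x t, a x t ^ (-γ - 1) = A x t ^ 2 / a x t ^ 2 := fun x t => by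
    rw [Real.rpow_sub_one (hapos x t).ne', apow]
    field_simp
  have apow_half : ∀ x t, a x t ^ (-((γ + 1) / 2)) = A x t / a x t := fun x t => by
    rw [← hA, ← Real.rpow_sub_one (hapos x t).ne']
    congr 1
    ring
  have hmfun : m = fun x t => Real.exp (S x t / (2 * ctau)) := funext₂ hm
  have hzfun : z = fun x t => Z * v x t ^ (-((γ - 1) / 2)) := funext₂ hz
  have hAreg : ContDiff ℝ 2 (fun w : ℝ × ℝ => A w.1 w.2) := by
    rw [hAdef]
    exact hareg.rpow_const_of_ne fun w => (hapos w.1 w.2).ne'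
  have hmreg : ContDiff ℝ 2 (fun w : ℝ × ℝ => m w.1 w.2) := by
    rw [hmfun]
    exact (hSreg.div_const _).exp
  have hzreg : ContDiff ℝ 2 (fun w : ℝ × ℝ => z w.1 w.2) := by
    rw [hzfun]
    exact contDiff_const.mul (hvreg.rpow_const_of_ne fun w => (hvpos w.1 w.2).ne')
  have had := hareg.differentiable two
  have hvd := hvreg.differentiable two
  have hAx : ∀ x t, pdx A x t = -((γ - 1) / 2) * A x t * (v x t * ad x t) / a x t :=
    fun x t => by rw [hAdef, pdx_rpow had hapos, hax]
  have hAt : ∀ x t, pdt A x t = -((γ - 1) / 2) * A x t * (u x t * ad x t) / a x t :=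
    fun x t => by rw [hAdef, pdt_rpow had hapos, hat]
  have hzx : ∀ x t, pdx z x t = -((γ - 1) / 2) * z x t * pdx v x t / v x t := fun x t => by
    have h : pdx z x t = Z * pdx (fun x t => v x t ^ (-((γ - 1) / 2))) x t := by
      rw [hzfun]
      exact deriv_const_mul_field Z
    rw [h, pdx_rpow hvd hvpos, hz]
    ring
  have hzt : ∀ x t, pdt z x t = -((γ - 1) / 2) * z x t * pdx u x t / v x t := fun x t => by
    have h : pdt z x t = Z * pdt (fun x t => v x t ^ (-((γ - 1) / 2))) x t := by
      rw [hzfun]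
      exact deriv_const_mul_field Z
    rw [h, pdt_rpow hvd hvpos, hz, sub_eq_zero.1 (hmass x t)]
    ring
  have hmt : ∀ x t, pdt m x t = 0 := fun x t => by
    rw [hmfun]
    refine (((hasDerivAt_pdt (hSreg.differentiable two) x t).div_const _).exp).deriv.trans ?_
    rw [hent]
    simp
  have hC' : ∀ x t, C x t = (γ - 1) / 2 * A x t * m x t * z x t / v x t := fun x t => by
    rw [hC, hA, zpow_add, ← hKK]
    ring
  obtain ⟨q, hq⟩ : ∃ q : ℝ → ℝ → ℝ, ∀ x t, q x t =
      A x t * (m x t * pdx z x t + (γ - 1) / γ * pdx m x t * z x t) := ⟨_, fun _ _ => rfl⟩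
  have hp' : ∀ x t, p x t = (γ - 1) ^ 2 / (4 * γ) * m x t ^ 2 * A x t ^ 2 * z x t ^ 2
      / (a x t * v x t) := fun x t => by
    have he : Real.exp (S x t / ctau) = m x t ^ 2 := by
      rw [hm, ← Real.exp_nat_mul]
      congr 1
      push_cast
      field_simp
    have hv0 := (hvpos x t).ne'
    have ha0 := (hapos x t).ne'
    rw [hp, he, apow, rpow_neg_eq_sq_div (hvpos x t), hz, mul_pow, hZ, div_pow, mul_pow, hs2]
    field_simp
    ring
  have hut : ∀ x t, pdt u x t = -(C x t * q x t)
      + ((γ - 1) / 2) ^ 2 * m x t ^ 2 * A x t ^ 2 * z x t ^ 2 * ad x t / a x t := fun x t => by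
    have hv0 := (hvpos x t).ne'
    have ha0 := (hapos x t).ne'
    have px : pdx p x t = _ :=
      ((((((hasDerivAt_pdx (hmreg.differentiable two) x t).pow 2).const_mul
        ((γ - 1) ^ 2 / (4 * γ))).mul ((hasDerivAt_pdx (hAreg.differentiable two) x t).pow 2)).mul
        ((hasDerivAt_pdx (hzreg.differentiable two) x t).pow 2)).div
        ((hasDerivAt_pdx had x t).mul (hasDerivAt_pdx hvd x t))
        (mul_ne_zero ha0 hv0)).congr_of_eventuallyEq (.of_forall fun y => hp' y t) |>.deriv
    rw [eq_neg_of_add_eq_zero_left (hmom x t), px]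
    simp only [Pi.mul_apply, Pi.pow_apply, hax, hAx, hC', hq, hzx]
    field_simp
    ring
  have hαfun : α = fun x t => pdx u x t + q x t := funext₂ fun x t => by rw [hα, hA, hq]
  have hβfun : β = fun x t => pdx u x t - q x t := funext₂ fun x t => by rw [hβ, hA, hq]
  intro x t
  have hv0 := (hvpos x t).ne'
  have ha0 := (hapos x t).ne'
  have hk1' : k1 x t = (γ + 1) / (4 * v x t) := by
    rw [hk1, zpow, hKc_eq]
    field_simp
    norm_num
  have hF' : F x t = (γ - 1) ^ 2 / 4 * m x t ^ 2 * z x t ^ 2 * v x t * (A x t ^ 2 / a x t ^ 2)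
        * (a x t * add x t - γ * ad x t ^ 2)
      + (γ - 1) ^ 2 / (2 * γ) * m x t * pdx m x t * z x t ^ 2
        * (A x t ^ 2 / a x t) * ad x t := by
    rw [hF, zpow_sub, apow_sub, apow, hKc_eq]
    field_simp
    ring
  have hαβ : α x t - β x t = 2 * q x t := by
    rw [hαfun, hβfun]
    ring
  have hβα : β x t - α x t = -(2 * q x t) := by rw [← hαβ, neg_sub]
  rw [hαβ, hβα, hk1', hF', hk2, hk3p, hk3m, hA, apow_half, hαfun, hβfun]
  exact riccati_of_reduced hγ hvreg hureg hareg hAreg hmreg hzreg hadreg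
    (fun x t => (hvpos x t).ne') (fun x t => (hapos x t).ne') hax hadx hAx hAt hzx hzt hmt hC' hq
    hut x t
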